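/- Let X be a compact Hausdorff space that is not metrizable. If X²∖Δ admits a partition {S_α : α < κ} such that each S_α is open in X²∖Δ and Lindelöf, then X contains a subspace homeomorphic to A(λ) for some uncountable cardinal λ. -/

import Mathlib

open Set TopologicalSpace Topology

/-- A Lindelöf piece off the diagonal is covered by countably many disjoint open rectangles. -/
theorem s4_rect {X : Type*} [TopologicalSpace X] [T2Space X]
    (A : Set {p : X × X // p.1 ≠ p.2}) (hA : IsLindelof A) :
    ∃ R : Set (Set X × Set X), R.Countable ∧
      (∀ r ∈ R, IsOpen r.1 ∧ IsOpen r.2 ∧ Disjoint r.1 r.2) ∧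
      ∀ p ∈ A, ∃ r ∈ R, p.1.1 ∈ r.1 ∧ p.1.2 ∈ r.2 := by
  have h : ∀ p : {p : X × X // p.1 ≠ p.2}, ∃ r : Set X × Set X,
      (IsOpen r.1 ∧ IsOpen r.2 ∧ Disjoint r.1 r.2) ∧ p.1.1 ∈ r.1 ∧ p.1.2 ∈ r.2 := by
    intro p
    obtain ⟨u, v, hu, hv, hxu, hyv, hd⟩ := t2_separation p.2
    exact ⟨(u, v), ⟨hu, hv, hd⟩, hxu, hyv⟩
  choose r hr hr' using h
  obtain ⟨t, ht, hAt⟩ := hA.elim_countable_subcover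
    (fun p => {q : {p : X × X // p.1 ≠ p.2} | q.1.1 ∈ (r p).1 ∧ q.1.2 ∈ (r p).2})
    (fun p => ((hr p).1.preimage (continuous_fst.comp continuous_subtype_val)).inter
      ((hr p).2.1.preimage (continuous_snd.comp continuous_subtype_val)))
    (fun p _ => mem_iUnion.2 ⟨p, hr' p⟩)
  refine ⟨r '' t, ht.image r, ?_, ?_⟩
  · rintro _ ⟨p, _, rfl⟩
    exact hr p
  · intro p hp
    obtain ⟨q, hq, hpq⟩ := mem_iUnion₂.1 (hAt hp)
    exact ⟨r q, mem_image_of_mem r hq, hpq⟩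

/-- Countably many disjoint open rectangles covering the off-diagonal give metrizability. -/
theorem s4_metr {X : Type*} [tX : TopologicalSpace X] [CompactSpace X] [T2Space X]
    (R : Set (Set X × Set X)) (hR : R.Countable)
    (ho : ∀ r ∈ R, IsOpen r.1 ∧ IsOpen r.2 ∧ Disjoint r.1 r.2)
    (hc : ∀ x y : X, x ≠ y → ∃ r ∈ R, x ∈ r.1 ∧ y ∈ r.2) : MetrizableSpace X := by
  let B : Set (Set X) := Prod.fst '' R ∪ Prod.snd '' R
  have hB : B.Countable := (hR.image _).union (hR.image _)
  have hle : tX ≤ generateFrom B := by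
    apply le_generateFrom
    rintro s (⟨r, hr, rfl⟩ | ⟨r, hr, rfl⟩)
    · exact (ho r hr).1
    · exact (ho r hr).2.1
  have ht2 : @T2Space X (generateFrom B) := by
    refine @T2Space.mk X (generateFrom B) ?_
    intro x y hxy
    obtain ⟨r, hr, hx, hy⟩ := hc x y hxy
    exact ⟨r.1, r.2, isOpen_generateFrom_of_mem (Or.inl ⟨r, hr, rfl⟩),
      isOpen_generateFrom_of_mem (Or.inr ⟨r, hr, rfl⟩), hx, hy, (ho r hr).2.2⟩
  have heq : tX = generateFrom B := by
    refine le_antisymm hle ?_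
    have hcont : @Continuous X X tX (generateFrom B) id := continuous_id_iff_le.2 hle
    have hcm : @IsClosedMap X X tX (generateFrom B) id :=
      @Continuous.isClosedMap X X tX (generateFrom B) _ ht2 id hcont
    intro s hs
    have h1 := hcm sᶜ (isClosed_compl_iff.2 hs)
    rw [image_id] at h1
    exact (@isClosed_compl_iff X (generateFrom B) s).1 h1
  haveI : SecondCountableTopology X := ⟨⟨B, hB, heq⟩⟩
  exact metrizableSpace_of_t3_secondCountable X

/-- The uncountable slice case. -/
theorem s4_A {X : Type*} [TopologicalSpace X] [CompactSpace X] [T2Space X]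
    {ι : Type*} (d : X) (U : ι → Set X) (hU : ∀ i, IsOpen (U i))
    (hdisj : ∀ i j x, x ∈ U i → x ∈ U j → i = j) (hd : ∀ i, d ∉ U i)
    (hcov : ∀ x, x ≠ d → ∃ i, x ∈ U i)
    (hunc : ¬ {i | (U i).Nonempty}.Countable) :
    ∃ (D : Type) (_ : TopologicalSpace D) (_ : DiscreteTopology D) (_ : Uncountable D)
      (Y : Set X), Nonempty (Y ≃ₜ OnePoint D) := by
  let D : Type := (Cardinal.aleph 1 : Cardinal.{0}).out
  have hDc : Cardinal.mk D = Cardinal.aleph 1 := Cardinal.mk_out _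
  have hDu : Uncountable D := by
    rw [← Cardinal.aleph0_lt_mk_iff, hDc]
    exact Cardinal.aleph0_lt_aleph_one
  have hemb : Nonempty (D ↪ {i | (U i).Nonempty}) := by
    rw [← Cardinal.lift_mk_le', hDc]
    simp only [Cardinal.lift_aleph, Ordinal.lift_one]
    rw [← Cardinal.lift_uzero (Cardinal.mk _), ← Cardinal.succ_aleph0, Order.succ_le_iff]
    have : ¬ Cardinal.mk {i | (U i).Nonempty} ≤ Cardinal.aleph0 := by
      rwa [Cardinal.le_aleph0_iff_set_countable]
    simpa using not_le.1 this
  obtain ⟨e⟩ := hemb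
  choose y hy using fun a => (e a).2
  have hyinj : Function.Injective y := by
    intro a b hab
    apply e.injective
    apply Subtype.ext
    exact hdisj _ _ (y a) (hy a) (hab ▸ hy b)
  letI tD : TopologicalSpace D := ⊥
  haveI : DiscreteTopology D := ⟨rfl⟩
  have htend : Filter.Tendsto y Filter.cofinite (𝓝 d) := by
    rw [tendsto_nhds]
    intro V hV hdV
    rw [Filter.mem_cofinite]
    have hK : IsCompact Vᶜ := hV.isClosed_compl.isCompact
    obtain ⟨t, ht⟩ := hK.elim_finite_subcover U hU (fun x hx => by
      obtain ⟨i, hi⟩ := hcov x (fun h => hx (h ▸ hdV))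
      exact mem_iUnion.2 ⟨i, hi⟩)
    have hinj : Function.Injective (fun a => (e a : ι)) :=
      Subtype.val_injective.comp e.injective
    refine (t.finite_toSet.preimage hinj.injOn).subset ?_
    intro a ha
    obtain ⟨i, hi, hai⟩ := mem_iUnion₂.1 (ht ha)
    have := hdisj _ _ _ (hy a) hai
    change (e a : ι) ∈ (t : Set ι)
    rw [this]
    exact hi
  let f : OnePoint D → X := fun o => OnePoint.elim o d y
  have hf : Continuous f := by
    rw [OnePoint.continuous_iff_from_discrete]
    exact htend
  have hfi : Function.Injective f := by
    intro a b hab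
    induction a using OnePoint.rec with
    | infty =>
      induction b using OnePoint.rec with
      | infty => rfl
      | coe b => exact absurd (show d ∈ U (e b) from (show d = y b from hab) ▸ hy b) (hd _)
    | coe a =>
      induction b using OnePoint.rec with
      | infty => exact absurd (show d ∈ U (e a) from (show y a = d from hab) ▸ hy a) (hd _)
      | coe b => exact congrArg _ (hyinj hab)
  exact ⟨D, tD, inferInstance, hDu, range f,
    ⟨(hf.isClosedEmbedding hfi).isEmbedding.toHomeomorph.symm⟩⟩

/-- If all horizontal slices meet countably many pieces, `X` is separable. -/
theorem s4_sep {X : Type*} [TopologicalSpace X] [CompactSpace X] [T2Space X]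
    {ι : Type*} (S : ι → Set {p : X × X // p.1 ≠ p.2})
    (hcover : (⋃ i, S i) = Set.univ)
    (hopen : ∀ i, IsOpen (S i))
    (hlin : ∀ i, IsLindelof (S i))
    (hctb : ∀ d : X, {i | ∃ p ∈ S i, p.1.2 = d}.Countable) :
    ∃ D : Set X, D.Countable ∧ Dense D := by
  classical
  rcases isEmpty_or_nonempty X with hX | hX
  · exact ⟨∅, countable_empty, fun x => (hX.false x).elim⟩
  choose R hRc hRo hRcov using fun i => s4_rect (S i) (hlin i)
  -- rectangles attached to a set of points
  let J : Set X → Set ι := fun D => ⋃ d ∈ D, {i | ∃ p ∈ S i, p.1.2 = d}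
  let Q : Set X → Set (Set X × Set X) := fun D => ⋃ i ∈ J D, R i
  have hJ : ∀ D : Set X, D.Countable → (J D).Countable := fun D hD =>
    hD.biUnion fun d _ => hctb d
  have hQ : ∀ D : Set X, D.Countable → (Q D).Countable := fun D hD =>
    (hJ D hD).biUnion fun i _ => hRc i
  have hQmono : ∀ D E : Set X, D ⊆ E → Q D ⊆ Q E := fun D E h =>
    biUnion_subset_biUnion_left (biUnion_subset_biUnion_left h)
  have hp : ∀ F : Set (Set X × Set X), ∃ x : X,
      (⋂ r ∈ F, r.1).Nonempty → x ∈ ⋂ r ∈ F, r.1 := by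
    intro F
    by_cases h : (⋂ r ∈ F, r.1).Nonempty
    · exact ⟨h.some, fun _ => h.some_mem⟩
    · exact ⟨Classical.arbitrary X, fun h' => absurd h' h⟩
  choose pt hpt using hp
  let step : Set X → Set X := fun D => D ∪ pt '' {F | F.Finite ∧ F ⊆ Q D}
  let E : ℕ → Set X := fun n => step^[n] ∅
  have hEs : ∀ n, E (n + 1) = step (E n) := fun n => Function.iterate_succ_apply' _ _ _
  have hEc : ∀ n, (E n).Countable := by
    intro n
    induction n with
    | zero => exact countable_empty
    | succ n ih =>
      rw [hEs]
      exact ih.union ((countable_ofPred_finite_subset (hQ _ ih)).image _)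
  have hEm : Monotone E := monotone_nat_of_le_succ fun n => by
    rw [hEs]; exact subset_union_left
  refine ⟨⋃ n, E n, countable_iUnion hEc, ?_⟩
  intro x
  by_contra hx
  set Z := closure (⋃ n, E n) with hZ
  have hcov : ∀ z : X, ∃ r : Set X × Set X, z ∈ Z →
      (r ∈ Q (⋃ n, E n) ∧ x ∈ r.1 ∧ z ∈ r.2) := by
    intro z
    by_cases hz : z ∈ Z
    swap
    · exact ⟨(∅, ∅), fun h => absurd h hz⟩
    have hne : x ≠ z := fun h => hx (h ▸ hz)
    have hmem : (⟨(x, z), hne⟩ : {p : X × X // p.1 ≠ p.2}) ∈ ⋃ i, S i := by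
      rw [hcover]; trivial
    obtain ⟨i, hi⟩ := mem_iUnion.1 hmem
    obtain ⟨r, hr, h1, h2⟩ := hRcov i _ hi
    refine ⟨r, fun _ => ⟨?_, h1, h2⟩⟩
    obtain ⟨W, hW, hWS⟩ := isOpen_induced_iff.1 (hopen i)
    have hWm : (x, z) ∈ W := by
      have : (⟨(x, z), hne⟩ : {p : X × X // p.1 ≠ p.2}) ∈ Subtype.val ⁻¹' W := by
        rw [hWS]; exact hi
      exact this
    have hO : IsOpen {w : X | (x, w) ∈ W ∧ w ≠ x} :=
      (hW.preimage (Continuous.prodMk_right x)).inter isOpen_ne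
    obtain ⟨d, ⟨hd1, hd2⟩, hdE⟩ := mem_closure_iff.1 hz _ hO ⟨hWm, hne.symm⟩
    refine mem_biUnion (x := i) ?_ hr
    refine mem_biUnion (x := d) hdE ?_
    refine ⟨⟨(x, d), hd2.symm⟩, ?_, rfl⟩
    rw [← hWS]
    exact hd1
  choose r hr using hcov
  have hro : ∀ z ∈ Z, IsOpen (r z).1 ∧ IsOpen (r z).2 ∧ Disjoint (r z).1 (r z).2 := by
    intro z hz
    obtain ⟨i, _, hi⟩ := mem_iUnion₂.1 (hr z hz).1
    exact hRo i _ hi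
  obtain ⟨t, htZ, htc⟩ := (isClosed_closure.isCompact : IsCompact Z).elim_nhds_subcover'
    (fun z _ => (r z).2) (fun z hz => (hro z hz).2.1.mem_nhds (hr z hz).2.2)
    |>.elim fun t ht => (⟨t.image Subtype.val, by
      intro z hz
      obtain ⟨w, _, rfl⟩ := Finset.mem_image.1 hz
      exact w.2, by
      intro z hz
      obtain ⟨w, hw, hzw⟩ := mem_iUnion₂.1 (ht hz)
      exact ⟨w, Finset.mem_image_of_mem _ hw, hzw⟩⟩ :
      ∃ t : Finset X, (∀ z ∈ t, z ∈ Z) ∧ ∀ z ∈ Z, ∃ w ∈ t, z ∈ (r w).2)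
  let F : Set (Set X × Set X) := r '' (t : Set X)
  have hFf : F.Finite := t.finite_toSet.image r
  have hFn : ∃ n, F ⊆ Q (E n) := by
    have h1 : ∀ z ∈ t, ∃ n, r z ∈ Q (E n) := by
      intro z hz
      obtain ⟨i, hi, hri⟩ := mem_iUnion₂.1 (hr z (htZ z hz)).1
      obtain ⟨d, hd, hid⟩ := mem_iUnion₂.1 hi
      obtain ⟨n, hn⟩ := mem_iUnion.1 hd
      exact ⟨n, mem_biUnion (x := i) (mem_biUnion (x := d) hn hid) hri⟩
    choose! n hn using h1
    refine ⟨t.sup n, ?_⟩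
    rintro _ ⟨z, hz, rfl⟩
    exact hQmono _ _ (hEm (Finset.le_sup (f := n) hz)) (hn z hz)
  obtain ⟨n, hn⟩ := hFn
  have hxF : x ∈ ⋂ q ∈ F, q.1 := by
    refine mem_iInter₂.2 ?_
    rintro _ ⟨z, hz, rfl⟩
    exact (hr z (htZ z hz)).2.1
  have hpF := hpt F ⟨x, hxF⟩
  have hpE : pt F ∈ E (n + 1) := by
    rw [hEs]
    exact Or.inr ⟨F, ⟨hFf, hn⟩, rfl⟩
  have hpZ : pt F ∈ Z := subset_closure (mem_iUnion.2 ⟨_, hpE⟩)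
  obtain ⟨w, hw, hpw⟩ := htc _ hpZ
  have h1 : pt F ∈ (r w).1 := mem_iInter₂.1 hpF (r w) ⟨w, hw, rfl⟩
  exact disjoint_left.1 (hro w (htZ w hw)).2.2 h1 hpw


open Set TopologicalSpace Topology

/-- A family of sets is locally finite at a point `x`: `x` has a neighborhood meeting
only finitely many members of the family. -/
def LocallyFiniteAt {X : Type*} [TopologicalSpace X] (x : X) (C : Set (Set X)) : Prop :=
  ∃ U ∈ nhds x, {A ∈ C | (A ∩ U).Nonempty}.Finite

/-- A family of sets is locally finite in `X`. -/
def LocallyFiniteFamily {X : Type*} [TopologicalSpace X] (C : Set (Set X)) : Prop :=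
  ∀ x : X, LocallyFiniteAt x C

/-- A poset is directed: every pair of elements has an upper bound. -/
def DirectedPoset (P : Type*) [Preorder P] : Prop :=
  ∀ a b : P, ∃ c : P, a ≤ c ∧ b ≤ c

/-- A poset has calibre (ω₁,ω) if every uncountable subset contains an infinite
subset with an upper bound. -/
def CalibreOmega1Omega (P : Type*) [Preorder P] : Prop :=
  ∀ S : Set P, ¬ S.Countable → ∃ T ⊆ S, T.Infinite ∧ ∃ b : P, ∀ t ∈ T, t ≤ b

/-- A collection `C` of subsets of `X` is `P`-locally finite. -/
def PLocallyFinite (P : Type*) [Preorder P] {X : Type*} [TopologicalSpace X]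
    (C : Set (Set X)) : Prop :=
  ∃ c : P → Set (Set X), (∀ p p' : P, p ≤ p' → c p ⊆ c p') ∧
    (∀ p, LocallyFiniteFamily (c p)) ∧ (⋃ p, c p) = C

def IsOpenCover {X : Type*} [TopologicalSpace X] (U : Set (Set X)) : Prop :=
  (∀ V ∈ U, IsOpen V) ∧ ⋃₀ U = univ

def IsRefinement {X : Type*} (V U : Set (Set X)) : Prop :=
  ∀ W ∈ V, ∃ W' ∈ U, W ⊆ W'

/-- `X` is `P`-paracompact: every open cover has a `P`-locally finite open refinement. -/
def PParacompact (P : Type*) [Preorder P] (X : Type*) [TopologicalSpace X] : Prop :=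
  ∀ U : Set (Set X), IsOpenCover U →
    ∃ V : Set (Set X), IsOpenCover V ∧ IsRefinement V U ∧ PLocallyFinite P V

/-- A collection is (ω₁,ω)-locally finite: every uncountable subcollection contains
an infinite locally finite subcollection. -/
def Omega1OmegaLF {X : Type*} [TopologicalSpace X] (C : Set (Set X)) : Prop :=
  ∀ D ⊆ C, ¬ D.Countable → ∃ E ⊆ D, E.Infinite ∧ LocallyFiniteFamily E

def Omega1OmegaParacompact (X : Type*) [TopologicalSpace X] : Prop :=
  ∀ U : Set (Set X), IsOpenCover U →
    ∃ V : Set (Set X), IsOpenCover V ∧ IsRefinement V U ∧ Omega1OmegaLF V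

/-- `B` is a base for the topology of `X`. -/
def IsBase {X : Type*} [TopologicalSpace X] (B : Set (Set X)) : Prop :=
  (∀ b ∈ B, IsOpen b) ∧ ∀ U : Set X, IsOpen U → ∀ x ∈ U, ∃ b ∈ B, x ∈ b ∧ b ⊆ U

/-- `X` is `P`-metrizable: it has a `(P × ℕ)`-locally finite base. -/
def PMetrizable (P : Type*) [Preorder P] (X : Type*) [TopologicalSpace X] : Prop :=
  ∃ B : Set (Set X), IsBase B ∧ PLocallyFinite (P × ℕ) B

def Omega1OmegaMetrizable (X : Type*) [TopologicalSpace X] : Prop :=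
  ∃ B : Set (Set X), IsBase B ∧ Omega1OmegaLF B

/-- Pseudocompact: every locally finite family of nonempty open sets is finite. -/
def Pseudocompact (X : Type*) [TopologicalSpace X] : Prop :=
  ∀ C : Set (Set X), (∀ U ∈ C, IsOpen U ∧ U.Nonempty) → LocallyFiniteFamily C → C.Finite

/-- The directed set of compact subsets of `M`, ordered by inclusion. -/
abbrev KM (M : Type*) [TopologicalSpace M] : Type _ := {K : Set M // IsCompact K}

/-- `X` is 𝒦(𝓜)-paracompact: every open cover has a `𝒦(M)`-locally finite open
refinement for some separable metrizable `M`. -/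
def KMclassParacompact (X : Type*) [TopologicalSpace X] : Prop :=
  ∀ U : Set (Set X), IsOpenCover U →
    ∃ (M : Type) (_ : TopologicalSpace M), SeparableSpace M ∧ MetrizableSpace M ∧
      ∃ V : Set (Set X), IsOpenCover V ∧ IsRefinement V U ∧ PLocallyFinite (KM M) V

/-- Weakly σ-locally finite collection. -/
def WeaklySigmaLF {X : Type*} [TopologicalSpace X] (C : Set (Set X)) : Prop :=
  ∃ c : ℕ → Set (Set X), (⋃ n, c n) = C ∧
    ∀ x : X, ∀ A ∈ C, ∃ n, A ∈ c n ∧ LocallyFiniteAt x (c n)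

/-- Relatively locally finite: locally finite at every point of its union. -/
def RelLocallyFinite {X : Type*} [TopologicalSpace X] (C : Set (Set X)) : Prop :=
  ∀ x ∈ ⋃₀ C, LocallyFiniteAt x C

def SigmaRelLF {X : Type*} [TopologicalSpace X] (C : Set (Set X)) : Prop :=
  ∃ c : ℕ → Set (Set X), (⋃ n, c n) = C ∧ ∀ n, RelLocallyFinite (c n)

def SigmaRelParacompact (X : Type*) [TopologicalSpace X] : Prop :=
  ∀ U : Set (Set X), IsOpenCover U →
    ∃ V : Set (Set X), IsOpenCover V ∧ IsRefinement V U ∧ SigmaRelLF V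

/-- An open set `U` is `P`-regular. -/
def PRegular (P : Type*) [Preorder P] {X : Type*} [TopologicalSpace X] (U : Set X) : Prop :=
  ∃ V : P × ℕ → Set X, (∀ q, IsOpen (V q)) ∧ (∀ q q' : P × ℕ, q ≤ q' → V q ⊆ V q') ∧
    (⋃ q, V q) = U ∧ (⋃ q, closure (V q)) = U

def PPerfectlyNormal (P : Type*) [Preorder P] (X : Type*) [TopologicalSpace X] : Prop :=
  ∀ U : Set X, IsOpen U → PRegular P U

/-- A development for `X`. -/
def IsDevelopment {X : Type*} [TopologicalSpace X] (G : ℕ → Set (Set X)) : Prop :=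
  (∀ n, IsOpenCover (G n)) ∧
    ∀ (x : X) (U : Set X), IsOpen U → x ∈ U → ∃ n, ⋃₀ {g ∈ G n | x ∈ g} ⊆ U

/-- A Moore space is a regular Hausdorff space with a development; here we record
just the existence of a development (regularity is a separate hypothesis). -/
def HasDevelopment (X : Type*) [TopologicalSpace X] : Prop :=
  ∃ G : ℕ → Set (Set X), IsDevelopment G

/-- Countably paracompact: every countable open cover has a locally finite open refinement. -/
def CountablyParacompact (X : Type*) [TopologicalSpace X] : Prop :=
  ∀ U : Set (Set X), IsOpenCover U → U.Countable →
    ∃ V : Set (Set X), IsOpenCover V ∧ IsRefinement V U ∧ LocallyFiniteFamily V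

/-- ccc: every pairwise disjoint family of nonempty open sets is countable. -/
def CCC (X : Type*) [TopologicalSpace X] : Prop :=
  ∀ C : Set (Set X), (∀ U ∈ C, IsOpen U ∧ U.Nonempty) → C.Pairwise Disjoint → C.Countable

/-- Cofinal subset of a preorder. -/
def CofinalSet {P : Type*} [Preorder P] (C : Set P) : Prop :=
  ∀ p : P, ∃ c ∈ C, p ≤ c

/-- `Q` is a Tukey quotient of `P`. -/
def TukeyQuotient (P : Type*) [Preorder P] (Q : Type*) [Preorder Q] : Prop :=
  ∃ φ : P → Q, ∀ C : Set P, CofinalSet C → CofinalSet (φ '' C)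
/-- Let `X` be compact Hausdorff and not metrizable. If `X² ∖ Δ` has a
partition into open Lindelöf subsets, then `X` contains a subspace homeomorphic to `A(λ)`
for some uncountable λ. -/
theorem statement4 (X : Type*) [TopologicalSpace X] [CompactSpace X] [T2Space X]
    (hnm : ¬ MetrizableSpace X)
    (ι : Type*) (S : ι → Set {p : X × X // p.1 ≠ p.2})
    (hnonempty : ∀ i, (S i).Nonempty)
    (hdisj : Pairwise (Function.onFun Disjoint S))
    (hcover : (⋃ i, S i) = Set.univ)
    (hopen : ∀ i, IsOpen (S i))
    (hlin : ∀ i, IsLindelof (S i)) :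
    ∃ (D : Type) (_ : TopologicalSpace D) (_ : DiscreteTopology D) (_ : Uncountable D)
      (Y : Set X), Nonempty (Y ≃ₜ OnePoint D) := by
  by_cases hctb : ∀ d : X, {i | ∃ p ∈ S i, p.1.2 = d}.Countable
  · exfalso
    apply hnm
    obtain ⟨D, hDc, hDd⟩ := s4_sep S hcover hopen hlin hctb
    have hι : (univ : Set ι).Countable := by
      refine (hDc.biUnion fun d _ => hctb d).mono ?_
      intro i _
      obtain ⟨⟨⟨a, b⟩, hab⟩, hi⟩ := hnonempty i
      obtain ⟨W, hW, hWS⟩ := isOpen_induced_iff.1 (hopen i)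
      have hWm : (a, b) ∈ W := by
        have : (⟨(a, b), hab⟩ : {p : X × X // p.1 ≠ p.2}) ∈ Subtype.val ⁻¹' W := by
          rw [hWS]; exact hi
        exact this
      have hO : IsOpen {w : X | (a, w) ∈ W ∧ w ≠ a} :=
        (hW.preimage (Continuous.prodMk_right a)).inter isOpen_ne
      obtain ⟨d, ⟨hd1, hd2⟩, hdE⟩ := mem_closure_iff.1 (hDd b) _ hO ⟨hWm, hab.symm⟩
      refine mem_biUnion (x := d) hdE ?_
      refine ⟨⟨(a, d), hd2.symm⟩, ?_, rfl⟩
      rw [← hWS]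
      exact hd1
    choose R hRc hRo hRcov using fun i => s4_rect (S i) (hlin i)
    refine s4_metr (⋃ i ∈ (univ : Set ι), R i) (hι.biUnion fun i _ => hRc i) ?_ ?_
    · intro r hr
      obtain ⟨i, _, hi⟩ := mem_iUnion₂.1 hr
      exact hRo i r hi
    · intro x y hxy
      have hmem : (⟨(x, y), hxy⟩ : {p : X × X // p.1 ≠ p.2}) ∈ ⋃ i, S i := by
        rw [hcover]; trivial
      obtain ⟨i, hi⟩ := mem_iUnion.1 hmem
      obtain ⟨r, hr, h⟩ := hRcov i _ hi
      exact ⟨r, mem_biUnion (mem_univ i) hr, h⟩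
  · push Not at hctb
    obtain ⟨d, hd⟩ := hctb
    refine s4_A d (fun i => {x | ∃ h : x ≠ d, (⟨(x, d), h⟩ : {p : X × X // p.1 ≠ p.2}) ∈ S i})
      ?_ ?_ ?_ ?_ ?_
    · intro i
      obtain ⟨W, hW, hWS⟩ := isOpen_induced_iff.1 (hopen i)
      have hO : IsOpen {w : X | (w, d) ∈ W ∧ w ≠ d} :=
        (hW.preimage (Continuous.prodMk_left d)).inter isOpen_ne
      convert hO using 1
      ext w
      constructor
      · rintro ⟨h, hw⟩
        rw [← hWS] at hw
        exact ⟨hw, h⟩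
      · rintro ⟨hw, h⟩
        refine ⟨h, ?_⟩
        rw [← hWS]
        exact hw
    · rintro i j x ⟨h, hi⟩ ⟨_, hj⟩
      by_contra hij
      exact disjoint_left.1 (hdisj hij) hi hj
    · rintro i ⟨h, _⟩
      exact h rfl
    · intro x hx
      have hmem : (⟨(x, d), hx⟩ : {p : X × X // p.1 ≠ p.2}) ∈ ⋃ i, S i := by
        rw [hcover]; trivial
      obtain ⟨i, hi⟩ := mem_iUnion.1 hmem
      exact ⟨i, hx, hi⟩
    · intro hc
      refine absurd (hc.mono ?_) hd
      rintro i ⟨⟨⟨a, b⟩, hab⟩, hi, rfl⟩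
      exact ⟨a, hab, hi⟩
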